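/- Let u : ℍ → ℝ be radial, H-convex, and continuously differentiable on ℝ³, and suppose the sublevel set Ω = {g ∈ ℍ : u(g) < 0} is nonempty. Then for every t ∈ ℝ with Ω ∩ H_{(0,0,t)} ≠ ∅, the set ∂_H u(Ω ∩ H_{(0,0,t)}) is a disc in ℝ² centered at the origin, i.e. it equals {p ∈ ℝ² : |p| < R} or {p ∈ ℝ² : |p| ≤ R} for some R ∈ [0,∞]. Consequently, ∂_H u(Ω) is also a disc (open or closed) in ℝ² centered at the origin. -/

import Mathlib

noncomputable section

open Filter Topology Set
open scoped ENNReal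

/-- The underlying set of the Heisenberg group `ℍ = ℝ³`, points `(x, y, t)`. -/
abbrev Hgrp : Type := ℝ × ℝ × ℝ

/-- Heisenberg group law `(x,y,t)·(x',y',t') = (x+x', y+y', t+t'+2(x'y−xy'))`. -/
def hmul (g g' : Hgrp) : Hgrp :=
  (g.1 + g'.1, g.2.1 + g'.2.1,
    g.2.2 + g'.2.2 + 2 * (g'.1 * g.2.1 - g.1 * g'.2.1))

/-- Inverse in the Heisenberg group. -/
def hinv (g : Hgrp) : Hgrp := (-g.1, -g.2.1, -g.2.2)

/-- Anisotropic dilation `δ_λ(x,y,t) = (λx, λy, λ²t)`. -/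
def hdil (l : ℝ) (g : Hgrp) : Hgrp := (l * g.1, l * g.2.1, l ^ 2 * g.2.2)

/-- Horizontal projection `ξ₁(x,y,t) = (x,y)`. -/
def xi1 (g : Hgrp) : ℝ × ℝ := (g.1, g.2.1)

/-- Exponential of a horizontal vector: `exp (a,b) = (a,b,0)`. -/
def hexp (v : ℝ × ℝ) : Hgrp := (v.1, v.2, 0)

/-- Euclidean inner product on `ℝ²`. -/
def dot (p q : ℝ × ℝ) : ℝ := p.1 * q.1 + p.2 * q.2

/-- Euclidean norm on `ℝ²`. -/
def enorm2 (p : ℝ × ℝ) : ℝ := Real.sqrt (p.1 ^ 2 + p.2 ^ 2)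

/-- The horizontal plane `H_{g₀} = {(x,y,t) : t = t₀ + 2y₀x − 2x₀y}`. -/
def hplane (g0 : Hgrp) : Set Hgrp :=
  {g | g.2.2 = g0.2.2 + 2 * g0.2.1 * g.1 - 2 * g0.1 * g.2.1}

/-- The H-subdifferential `∂_H u(g₀)` of `u : Ω → ℝ` at `g₀`. -/
def hsub (Ω : Set Hgrp) (u : Hgrp → ℝ) (g0 : Hgrp) : Set (ℝ × ℝ) :=
  {p | ∀ g ∈ hplane g0 ∩ Ω, u g ≥ u g0 + dot p (xi1 g - xi1 g0)}

/-- The H-normal map: `∂_H u(E) = ⋃_{g ∈ E} ∂_H u(g)`. -/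
def hsubSet (Ω : Set Hgrp) (u : Hgrp → ℝ) (E : Set Hgrp) : Set (ℝ × ℝ) :=
  ⋃ g ∈ E, hsub Ω u g

/-- H-convexity of a set. -/
def HConvexSet (Ω : Set Hgrp) : Prop :=
  ∀ g ∈ Ω, ∀ g' ∈ hplane g ∩ Ω, ∀ l ∈ Set.Icc (0:ℝ) 1,
    hmul g (hdil l (hmul (hinv g) g')) ∈ Ω

/-- H-convexity (weak H-convexity) of a function on `Ω`. -/
def HConvexOn (Ω : Set Hgrp) (u : Hgrp → ℝ) : Prop :=
  ∀ g ∈ Ω, ∀ g' ∈ hplane g ∩ Ω, ∀ l ∈ Set.Icc (0:ℝ) 1,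
    u (hmul g (hdil l (hmul (hinv g) g'))) ≤ u g + l * (u g' - u g)

/-- Strict H-convexity of a function on all of `ℍ`. -/
def StrictHConvexOn (u : Hgrp → ℝ) : Prop :=
  HConvexOn Set.univ u ∧
    ∀ g : Hgrp, ∀ g' ∈ hplane g, g ≠ g' → ∀ l ∈ Set.Icc (0:ℝ) 1,
      u (hmul g (hdil l (hmul (hinv g) g'))) = u g + l * (u g' - u g) →
        l = 0 ∨ l = 1

/-- The Korányi gauge `‖(x,y,t)‖_ℍ = ((x²+y²)² + t²)^{1/4}`. -/
def kgauge (g : Hgrp) : ℝ := ((g.1 ^ 2 + g.2.1 ^ 2) ^ 2 + g.2.2 ^ 2) ^ ((1:ℝ)/4)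

/-- The Korányi distance `ρ(g,g') = ‖g⁻¹·g'‖_ℍ`. -/
def kdist (g g' : Hgrp) : ℝ := kgauge (hmul (hinv g) g')

/-- A function on `ℍ` is radial if `u(x,y,t) = U(√(x²+y²), t)`. -/
def IsRadial (u : Hgrp → ℝ) : Prop :=
  ∃ U : ℝ × ℝ → ℝ, ∀ x y t : ℝ, u (x, y, t) = U (Real.sqrt (x ^ 2 + y ^ 2), t)

/-- Horizontal derivative `Xu = ∂u/∂x + 2y ∂u/∂t`. -/
def Xd (u : Hgrp → ℝ) (g : Hgrp) : ℝ :=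
  fderiv ℝ u g (1, 0, 0) + 2 * g.2.1 * fderiv ℝ u g (0, 0, 1)

/-- Horizontal derivative `Yu = ∂u/∂y − 2x ∂u/∂t`. -/
def Yd (u : Hgrp → ℝ) (g : Hgrp) : ℝ :=
  fderiv ℝ u g (0, 1, 0) - 2 * g.1 * fderiv ℝ u g (0, 0, 1)

/-- Difference quotient of `u` at `g` in the `X` direction. -/
def XdiffQuot (u : Hgrp → ℝ) (g : Hgrp) (l : ℝ) : ℝ := (u (hmul g (l, 0, 0)) - u g) / l

/-- Difference quotient of `u` at `g` in the `Y` direction. -/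
def YdiffQuot (u : Hgrp → ℝ) (g : Hgrp) (l : ℝ) : ℝ := (u (hmul g (0, l, 0)) - u g) / l

/-- Existence of the two-sided limit `Xu(g)`. -/
def XlimExists (u : Hgrp → ℝ) (g : Hgrp) : Prop :=
  ∃ a : ℝ, Filter.Tendsto (XdiffQuot u g) (nhdsWithin 0 {0}ᶜ) (nhds a)

/-- Existence of the two-sided limit `Yu(g)`. -/
def YlimExists (u : Hgrp → ℝ) (g : Hgrp) : Prop :=
  ∃ a : ℝ, Filter.Tendsto (YdiffQuot u g) (nhdsWithin 0 {0}ᶜ) (nhds a)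

/-- The value `Xu(g)` (defined via choice where the limit exists, else `0`). -/
def XuVal (u : Hgrp → ℝ) (g : Hgrp) : ℝ :=
  haveI := Classical.dec (XlimExists u g)
  if h : XlimExists u g then h.choose else 0

/-- The value `Yu(g)`. -/
def YuVal (u : Hgrp → ℝ) (g : Hgrp) : ℝ :=
  haveI := Classical.dec (YlimExists u g)
  if h : YlimExists u g then h.choose else 0

/-- The horizontal gradient `𝕏u(g) = (Xu(g), Yu(g))`. -/
def XXgrad (u : Hgrp → ℝ) (g : Hgrp) : ℝ × ℝ := (XuVal u g, YuVal u g)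

/-- The circle `C(t,R) = {(x,y,t) : x²+y² = R²}`. -/
def Ccirc (t R : ℝ) : Set Hgrp := {g | g.2.2 = t ∧ g.1 ^ 2 + g.2.1 ^ 2 = R ^ 2}

/-- A disc (open or closed) in `ℝ²` centered at the origin, of radius `R ∈ [0,∞]`. -/
def IsCenteredDisc (S : Set (ℝ × ℝ)) : Prop :=
  ∃ R : ℝ≥0∞, S = {p : ℝ × ℝ | ENNReal.ofReal (enorm2 p) < R} ∨
    S = {p : ℝ × ℝ | ENNReal.ofReal (enorm2 p) ≤ R}

/-- Diameter of a subset of `ℍ` with respect to the Korányi distance. -/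
def kdiam (S : Set Hgrp) : ℝ≥0∞ :=
  ⨆ a ∈ S, ⨆ b ∈ S, ENNReal.ofReal (kdist a b)

/-- The 2-dimensional Hausdorff (outer) measure of the metric space `(ℍ, ρ)`. -/
def kHaus2 (S : Set Hgrp) : ℝ≥0∞ :=
  ⨆ (ε : ℝ≥0∞) (_ : 0 < ε),
    ⨅ (c : ℕ → Set Hgrp) (_ : S ⊆ ⋃ n, c n) (_ : ∀ n, kdiam (c n) ≤ ε),
      ∑' n, (kdiam (c n)) ^ 2

/-- The set `D` of points of `Ω` where both horizontal derivatives exist. -/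
def Dset (Ω : Set Hgrp) (u : Hgrp → ℝ) : Set Hgrp :=
  {g ∈ Ω | XlimExists u g ∧ YlimExists u g}

/-- The level set `Σ^E_v = {g ∈ E ∩ D : 𝕏u(g) = v}`. -/
def SigmaSet (Ω : Set Hgrp) (u : Hgrp → ℝ) (E : Set Hgrp) (v : ℝ × ℝ) : Set Hgrp :=
  {g ∈ E ∩ Dset Ω u | XXgrad u g = v}

/-- The Monge–Ampère set function `ν_u(E) = ∫_{ℝ²} 𝓗²_ρ(Σ^E_v) dv`. -/
def nuMA (Ω : Set Hgrp) (u : Hgrp → ℝ) (E : Set Hgrp) : ℝ≥0∞ :=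
  ∫⁻ v : ℝ × ℝ, kHaus2 (SigmaSet Ω u E v)

/-- Moving from `g` along the horizontal vector `(a, b)`. -/
lemma hmul_hdil_hinv_hmul {g g' : Hgrp} (h : g' ∈ hplane g) (l : ℝ) :
    hmul g (hdil l (hmul (hinv g) g')) =
      g + l • ((g'.1 - g.1, g'.2.1 - g.2.1,
        2 * ((g'.1 - g.1) * g.2.1 - g.1 * (g'.2.1 - g.2.1))) : Hgrp) := by
  obtain ⟨x, y, t⟩ := g
  obtain ⟨x', y', t'⟩ := g'
  simp only [hplane, mem_ofPred_eq] at h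
  subst h
  simp only [hmul, hdil, hinv, Prod.smul_mk, Prod.mk_add_mk, smul_eq_mul, Prod.mk.injEq]
  refine ⟨by ring, by ring, by ring⟩

lemma hasDerivAt_horizontal {u : Hgrp → ℝ} {g : Hgrp} (hu : DifferentiableAt ℝ u g) (a b : ℝ) :
    HasDerivAt (fun l : ℝ => u (g + l • ((a, b, 2 * (a * g.2.1 - g.1 * b)) : Hgrp)))
      (dot (Xd u g, Yd u g) (a, b)) 0 := by
  set w : Hgrp := (a, b, 2 * (a * g.2.1 - g.1 * b)) with hw
  have hline : HasDerivAt (fun l : ℝ => g + l • w) w 0 := by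
    simpa using ((hasDerivAt_id (0 : ℝ)).smul_const w).const_add g
  have hg : HasFDerivAt u (fderiv ℝ u g) (g + (0 : ℝ) • w) := by simpa using hu.hasFDerivAt
  have hsplit : w = a • ((1, 0, 0) : Hgrp) + b • ((0, 1, 0) : Hgrp) +
      (2 * (a * g.2.1 - g.1 * b)) • ((0, 0, 1) : Hgrp) := by
    simp [hw]
  have hval : fderiv ℝ u g w = dot (Xd u g, Yd u g) (a, b) := by
    rw [hsplit, map_add, map_add, map_smul, map_smul, map_smul]
    simp only [dot, Xd, Yd, smul_eq_mul]
    ring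
  exact hval ▸ hg.comp_hasDerivAt (0 : ℝ) hline

/-- A differentiable H-convex function has its horizontal gradient as only H-subgradient. -/
lemma hsub_eq_singleton {u : Hgrp → ℝ} (hconv : HConvexOn univ u) {g : Hgrp}
    (hu : DifferentiableAt ℝ u g) : hsub univ u g = {(Xd u g, Yd u g)} := by
  ext p
  rw [mem_singleton_iff]
  constructor
  · intro hp
    have key : ∀ a b : ℝ, dot (Xd u g, Yd u g) (a, b) = dot p (a, b) := by
      intro a b
      have hd := (hasDerivAt_horizontal hu a b).sub
        ((hasDerivAt_id (0 : ℝ)).mul_const (dot p (a, b)))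
      have hmin : IsLocalMin ((fun l : ℝ => u (g + l • ((a, b, 2 * (a * g.2.1 - g.1 * b)) : Hgrp)))
          - fun l => id l * dot p (a, b)) 0 := by
        refine Eventually.of_forall fun l => ?_
        have hl := hp (g + l • ((a, b, 2 * (a * g.2.1 - g.1 * b)) : Hgrp)) ⟨by
          simp only [hplane, mem_ofPred_eq, Prod.fst_add, Prod.snd_add, Prod.smul_fst,
            Prod.smul_snd, smul_eq_mul]
          ring, mem_univ _⟩
        simp only [dot, xi1, Prod.fst_add, Prod.snd_add, Prod.smul_fst, Prod.smul_snd,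
          smul_eq_mul, Prod.mk_sub_mk] at hl
        simp only [Pi.sub_apply, id, dot, zero_smul, add_zero, zero_mul, sub_zero]
        linarith
      have := hmin.hasDerivAt_eq_zero hd
      linarith
    have h1 := key 1 0
    have h2 := key 0 1
    simp only [dot, mul_one, mul_zero, add_zero, zero_add] at h1 h2
    exact Prod.ext h1.symm h2.symm
  · rintro rfl g' ⟨hg', -⟩
    have hd := hasDerivAt_horizontal hu (g'.1 - g.1) (g'.2.1 - g.2.1)
    have hlim := (hasDerivWithinAt_iff_tendsto_slope' (self_notMem_Ioi (a := (0 : ℝ)))).1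
      hd.hasDerivWithinAt
    have hle : dot (Xd u g, Yd u g) (g'.1 - g.1, g'.2.1 - g.2.1) ≤ u g' - u g := by
      refine le_of_tendsto hlim ?_
      filter_upwards [Ioc_mem_nhdsGT (zero_lt_one (α := ℝ))] with l hl
      have := hconv g (mem_univ _) g' ⟨hg', mem_univ _⟩ l ⟨hl.1.le, hl.2⟩
      rw [hmul_hdil_hinv_hmul hg'] at this
      rw [slope_def_field, div_le_iff₀ (by linarith [hl.1])]
      simp only [zero_smul, add_zero, sub_zero]
      linarith
    simp only [xi1, Prod.mk_sub_mk]
    linarith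

lemma continuous_Xd {u : Hgrp → ℝ} (hu : ContDiff ℝ 1 u) : Continuous (Xd u) := by
  have := hu.continuous_fderiv one_ne_zero
  unfold Xd
  fun_prop

lemma continuous_Yd {u : Hgrp → ℝ} (hu : ContDiff ℝ 1 u) : Continuous (Yd u) := by
  have := hu.continuous_fderiv one_ne_zero
  unfold Yd
  fun_prop

/-- The linear map of `ℝ²` with complex multiplier `c + s i`. -/
def rot (c s : ℝ) (p : ℝ × ℝ) : ℝ × ℝ := (c * p.1 - s * p.2, s * p.1 + c * p.2)

lemma exists_rot_eq {p q : ℝ × ℝ} (h : enorm2 p = enorm2 q) :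
    ∃ c s : ℝ, c ^ 2 + s ^ 2 = 1 ∧ rot c s p = q := by
  have hsq : p.1 ^ 2 + p.2 ^ 2 = q.1 ^ 2 + q.2 ^ 2 :=
    (Real.sqrt_inj (by positivity) (by positivity)).1 h
  obtain ⟨a, b⟩ := p
  obtain ⟨a', b'⟩ := q
  simp only at hsq
  rcases eq_or_ne (a ^ 2 + b ^ 2) 0 with h0 | h0
  · have ha : a = 0 := by nlinarith [sq_nonneg a, sq_nonneg b]
    have hb : b = 0 := by nlinarith [sq_nonneg a, sq_nonneg b]
    have ha' : a' = 0 := by nlinarith [sq_nonneg a', sq_nonneg b']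
    have hb' : b' = 0 := by nlinarith [sq_nonneg a', sq_nonneg b']
    exact ⟨1, 0, by norm_num, by simp [rot, ha, hb, ha', hb']⟩
  · refine ⟨(a * a' + b * b') / (a ^ 2 + b ^ 2), (a * b' - b * a') / (a ^ 2 + b ^ 2), ?_, ?_⟩
    · rw [div_pow, div_pow, ← add_div, div_eq_one_iff_eq (by positivity)]
      linear_combination (-(a ^ 2 + b ^ 2)) * hsq
    · simp only [rot, Prod.mk.injEq]
      constructor <;> field_simp <;> ring

lemma IsRadial.apply_rot {u : Hgrp → ℝ} (hrad : IsRadial u) {c s : ℝ} (hcs : c ^ 2 + s ^ 2 = 1)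
    (x y t : ℝ) : u ((rot c s (x, y)).1, (rot c s (x, y)).2, t) = u (x, y, t) := by
  obtain ⟨U, hU⟩ := hrad
  rw [hU, hU]
  congr 3
  simp only [rot]
  linear_combination (x ^ 2 + y ^ 2) * hcs

/-- The H-subdifferential of a radial function is equivariant under rotations. -/
lemma IsRadial.rot_mem_hsub {u : Hgrp → ℝ} (hrad : IsRadial u) {c s : ℝ}
    (hcs : c ^ 2 + s ^ 2 = 1) {x y t : ℝ} {p : ℝ × ℝ} (hp : p ∈ hsub univ u (x, y, t)) :
    rot c s p ∈ hsub univ u ((rot c s (x, y)).1, (rot c s (x, y)).2, t) := by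
  rintro ⟨x', y', t'⟩ ⟨hg', -⟩
  have hcs' : c ^ 2 + (-s) ^ 2 = 1 := by rwa [neg_sq]
  have h := hp ((rot c (-s) (x', y')).1, (rot c (-s) (x', y')).2, t') ⟨by
    simp only [hplane, rot, mem_ofPred_eq] at hg' ⊢
    linarith, mem_univ _⟩
  rw [hrad.apply_rot hcs'] at h
  rw [hrad.apply_rot hcs]
  simp only [rot, dot, xi1, Prod.mk_sub_mk] at h ⊢
  have : (c * p.1 - s * p.2) * (x' - (c * x - s * y)) + (s * p.1 + c * p.2) * (y' - (s * x + c * y))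
      = p.1 * (c * x' - -s * y' - x) + p.2 * (-s * x' + c * y' - y) := by
    linear_combination (-(p.1 * x + p.2 * y)) * hcs
  linarith

lemma isCenteredDisc_of_forall_enorm2_le {S : Set (ℝ × ℝ)}
    (hS : ∀ p ∈ S, ∀ q, enorm2 q ≤ enorm2 p → q ∈ S) : IsCenteredDisc S := by
  set R : ℝ≥0∞ := ⨆ p ∈ S, ENNReal.ofReal (enorm2 p) with hR
  have hle : ∀ p ∈ S, ENNReal.ofReal (enorm2 p) ≤ R := fun p hp =>
    le_iSup₂ (f := fun p (_ : p ∈ S) => ENNReal.ofReal (enorm2 p)) p hp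
  have hlower : ∀ p ∈ S, ∀ q, ENNReal.ofReal (enorm2 q) ≤ ENNReal.ofReal (enorm2 p) → q ∈ S :=
    fun p hp q hq => hS p hp q ((ENNReal.ofReal_le_ofReal_iff (Real.sqrt_nonneg _)).1 hq)
  refine ⟨R, ?_⟩
  by_cases hmax : ∃ p ∈ S, ENNReal.ofReal (enorm2 p) = R
  · obtain ⟨p, hp, hpR⟩ := hmax
    exact Or.inr (Subset.antisymm hle fun q hq => hlower p hp q (hpR ▸ hq))
  · push Not at hmax
    refine Or.inl (Subset.antisymm (fun p hp => (hle p hp).lt_of_ne (hmax p hp)) fun q hq => ?_)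
    obtain ⟨p, hp, hqp⟩ := lt_biSup_iff.1 (show ENNReal.ofReal (enorm2 q) < R from hq)
    exact hlower p hp q hqp.le

lemma IsRadial.hsub_center {u : Hgrp → ℝ} (hrad : IsRadial u) (hconv : HConvexOn univ u)
    {t : ℝ} (hu : DifferentiableAt ℝ u (0, 0, t)) :
    Xd u (0, 0, t) = 0 ∧ Yd u (0, 0, t) = 0 := by
  have hs := hsub_eq_singleton hconv hu
  have h := hrad.rot_mem_hsub (c := -1) (s := 0) (by norm_num)
    (hs ▸ mem_singleton (Xd u (0, 0, t), Yd u (0, 0, t)))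
  simp only [rot, mul_zero, sub_zero, add_zero] at h
  rw [hs, mem_singleton_iff, Prod.mk.injEq] at h
  constructor <;> linarith [h.1, h.2]

/-- The value of `u` at a given height does not increase when shrinking towards the axis. -/
lemma IsRadial.apply_smul_le {u : Hgrp → ℝ} (hrad : IsRadial u) (hconv : HConvexOn univ u)
    (x y t : ℝ) {s : ℝ} (hs : s ∈ Icc (0 : ℝ) 1) : u (s * x, s * y, t) ≤ u (x, y, t) := by
  have hmem : ((-x, -y, t) : Hgrp) ∈ hplane (x, y, t) := by
    simp only [hplane, mem_ofPred_eq]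
    ring
  have h := hconv (x, y, t) (mem_univ _) (-x, -y, t) ⟨hmem, mem_univ _⟩ ((1 - s) / 2)
    ⟨by linarith [hs.2], by linarith [hs.1]⟩
  have hneg : u (-x, -y, t) = u (x, y, t) := by
    simpa [rot] using hrad.apply_rot (c := -1) (s := 0) (by norm_num) x y t
  rw [hmul_hdil_hinv_hmul hmem, hneg, sub_self, mul_zero, add_zero] at h
  convert h using 2
  simp only [Prod.smul_mk, Prod.mk_add_mk, smul_eq_mul, Prod.mk.injEq]
  refine ⟨by ring, by ring, by ring⟩

/-- Any vector no longer than an H-subgradient at height `t` inside `{u < a}` is again one. -/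
lemma IsRadial.exists_mem_hsub_of_enorm2_le {u : Hgrp → ℝ} (hrad : IsRadial u)
    (hconv : HConvexOn univ u) (hu : ContDiff ℝ 1 u) {x y t a : ℝ} (ha : u (x, y, t) < a)
    {p q : ℝ × ℝ} (hp : p ∈ hsub univ u (x, y, t)) (hq : enorm2 q ≤ enorm2 p) :
    ∃ x' y' : ℝ, u (x', y', t) < a ∧ q ∈ hsub univ u (x', y', t) := by
  have hd : Differentiable ℝ u := hu.differentiable one_ne_zero
  have hX := continuous_Xd hu
  have hY := continuous_Yd hu
  set N : ℝ → ℝ := fun s => enorm2 (Xd u (s * x, s * y, t), Yd u (s * x, s * y, t)) with hN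
  have hNc : Continuous N := by
    unfold N enorm2
    fun_prop
  have h0 : N 0 = 0 := by
    obtain ⟨h1, h2⟩ := hrad.hsub_center hconv (hd (0, 0, t))
    simp [hN, enorm2, h1, h2]
  have h1 : N 1 = enorm2 p := by
    rw [hsub_eq_singleton hconv (hd _), mem_singleton_iff] at hp
    simp [hN, hp]
  obtain ⟨s, hs, hsq⟩ := intermediate_value_Icc zero_le_one hNc.continuousOn
    (show enorm2 q ∈ Icc (N 0) (N 1) from ⟨h0.trans_le (Real.sqrt_nonneg _), hq.trans_eq h1.symm⟩)
  obtain ⟨c, r, hcr, hrot⟩ := exists_rot_eq hsq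
  refine ⟨_, _, ?_, hrot ▸ hrad.rot_mem_hsub hcr
    (hsub_eq_singleton hconv (hd (s * x, s * y, t)) ▸ mem_singleton _)⟩
  rw [hrad.apply_rot hcr]
  exact (hrad.apply_smul_le hconv x y t hs).trans_lt ha

/-- for a radial, H-convex, `C¹` function with nonempty sublevel set
`Ω = {u < 0}`, each slice image `∂_H u(Ω ∩ H_{(0,0,t)})` is a centered disc (open or
closed), and so is `∂_H u(Ω)`. -/
theorem stmt13 (u : Hgrp → ℝ) (hrad : IsRadial u) (hconv : HConvexOn Set.univ u)
    (hu : ContDiff ℝ 1 u) (hne : {g : Hgrp | u g < 0}.Nonempty) :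
    (∀ t : ℝ, ({g : Hgrp | u g < 0} ∩ hplane ((0:ℝ), (0:ℝ), t)).Nonempty →
      IsCenteredDisc
        (hsubSet Set.univ u ({g : Hgrp | u g < 0} ∩ hplane ((0:ℝ), (0:ℝ), t)))) ∧
    IsCenteredDisc (hsubSet Set.univ u {g : Hgrp | u g < 0}) := by
  constructor
  · intro t _
    refine isCenteredDisc_of_forall_enorm2_le fun p hp q hq => ?_
    simp only [hsubSet, mem_iUnion] at hp ⊢
    obtain ⟨⟨x, y, t'⟩, ⟨hneg, ht'⟩, hp⟩ := hp
    obtain rfl : t' = t := by simpa [hplane] using ht'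
    obtain ⟨x', y', hneg', hq'⟩ := hrad.exists_mem_hsub_of_enorm2_le hconv hu hneg hp hq
    exact ⟨(x', y', t'), ⟨hneg', by simp [hplane]⟩, hq'⟩
  · refine isCenteredDisc_of_forall_enorm2_le fun p hp q hq => ?_
    simp only [hsubSet, mem_iUnion] at hp ⊢
    obtain ⟨⟨x, y, t⟩, hneg, hp⟩ := hp
    obtain ⟨x', y', hneg', hq'⟩ := hrad.exists_mem_hsub_of_enorm2_le hconv hu hneg hp hq
    exact ⟨(x', y', t), hneg', hq'⟩
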